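/- arXiv:1802.07706 — 11 statements merged into one kernel-verified Lean document; each statement's English description precedes it below -/
import Mathlib

section
/- A point x = (x¹,x²,x³,x⁴,x⁵) ∈ ℝ^5 satisfies f(x) = 0 if and only if either x³ = x⁴ = x⁵ = 0 (i.e., x = (m, n, 0, 0, 0) for some m, n ∈ ℝ) or x¹ = x² = x³ = x⁴ = 0 (i.e., x = (0, 0, 0, 0, m) for some m ∈ ℝ). Consequently, the set of equilibrium states of the 5D Maxwell–Bloch model is exactly the union of the two families E₁ = {(m,n,0,0,0) : m,n ∈ ℝ} and E₂ = {(0,0,0,0,m) : m ∈ ℝ}. -/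
open Polynomial Matrix

/-- The 5D Maxwell–Bloch vector field on ℝ^5. -/
noncomputable def mbField (x : Fin 5 → ℝ) : Fin 5 → ℝ :=
  ![x 2, x 3, x 0 * x 4, x 1 * x 4, -(x 0 * x 2 + x 1 * x 3)]

theorem mbField_eq_zero_iff (x : Fin 5 → ℝ) : mbField x = 0 ↔
    ((x 2 = 0 ∧ x 3 = 0 ∧ x 4 = 0) ∨ (x 0 = 0 ∧ x 1 = 0 ∧ x 2 = 0 ∧ x 3 = 0)) := by
  simp only [mbField, funext_iff, Fin.forall_fin_succ, IsEmpty.forall_iff]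
  simp
  grind

theorem mbField_equilibria :
    (∀ x : Fin 5 → ℝ, mbField x = 0 ↔
      ((x 2 = 0 ∧ x 3 = 0 ∧ x 4 = 0) ∨ (x 0 = 0 ∧ x 1 = 0 ∧ x 2 = 0 ∧ x 3 = 0))) ∧
    {x : Fin 5 → ℝ | mbField x = 0} =
      {x : Fin 5 → ℝ | ∃ m n : ℝ, x = ![m, n, 0, 0, 0]} ∪
      {x : Fin 5 → ℝ | ∃ m : ℝ, x = ![0, 0, 0, 0, m]} := by
  refine ⟨mbField_eq_zero_iff, ?_⟩
  ext x
  rw [Set.mem_ofPred_eq, mbField_eq_zero_iff]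
  constructor
  · rintro (⟨h2, h3, h4⟩ | ⟨h0, h1, h2, h3⟩)
    · exact Or.inl ⟨x 0, x 1, by ext i; fin_cases i <;> simp [*]⟩
    · exact Or.inr ⟨x 4, by ext i; fin_cases i <;> simp [*]⟩
  · rintro (⟨m, n, rfl⟩ | ⟨m, rfl⟩) <;> simp
end

section
/- For all m, n ∈ ℝ, the characteristic polynomial of the Jacobian matrix J(e₁^{mn}) at the equilibrium e₁^{mn} = (m, n, 0, 0, 0) equals X³ · (X² + m² + n²). -/
open Polynomial Matrix

/-- The Jacobian matrix of the 5D Maxwell–Bloch vector field at x. -/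
noncomputable def mbJacobian (x : Fin 5 → ℝ) : Matrix (Fin 5) (Fin 5) ℝ :=
  !![0, 0, 1, 0, 0;
     0, 0, 0, 1, 0;
     x 4, 0, 0, 0, x 0;
     0, x 4, 0, 0, x 1;
     -(x 2), -(x 3), -(x 0), -(x 1), 0]

/-- The controlled Jacobian J(x,k) = J(x) - diag(k₁,...,k₅). -/
noncomputable def mbJacobianCtrl (x k : Fin 5 → ℝ) : Matrix (Fin 5) (Fin 5) ℝ :=
  mbJacobian x - Matrix.diagonal k

theorem charpoly_e1 (m n : ℝ) :
    (mbJacobian ![m, n, 0, 0, 0]).charpoly = X ^ 3 * (X ^ 2 + C (m ^ 2 + n ^ 2)) := by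
  have hM : (mbJacobian ![m, n, 0, 0, 0]).charmatrix =
      !![X, 0, -1, 0, 0;
         0, X, 0, -1, 0;
         0, 0, X, 0, -C m;
         0, 0, 0, X, -C n;
         0, 0, C m, C n, X] := by
    ext1 i j
    fin_cases i <;> fin_cases j <;> simp [mbJacobian]
  rw [Matrix.charpoly, hM]
  simp [det_succ_row_zero, Fin.sum_univ_succ, Fin.succAbove]
  ring
end

section
/- Let m > 0. Then √m is an eigenvalue of J(e₂^m), where e₂^m = (0, 0, 0, 0, m), and it is a positive real number. Consequently, for every α ∈ (0, 1] there exists a nonzero eigenvalue λ of J(e₂^m) with |Arg λ| < απ/2; that is, Matignon's condition for asymptotic stability of the fractional system of order α fails at e₂^m for every α ∈ (0, 1]. -/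
open Polynomial Matrix

/-- An eigenvalue, witnessed by a nonzero eigenvector, is a root of the characteristic polynomial. -/
theorem isRoot_charpoly_of_mulVec_eq_smul {R n : Type*} [CommRing R] [IsDomain R] [Fintype n]
    [DecidableEq n] {M : Matrix n n R} {t : R} {v : n → R} (hv : v ≠ 0) (h : M *ᵥ v = t • v) :
    M.charpoly.IsRoot t := by
  rw [Polynomial.IsRoot.def, Matrix.eval_charpoly]
  refine Matrix.exists_mulVec_eq_zero_iff.mp ⟨v, hv, ?_⟩
  simp [Matrix.sub_mulVec, h]

/-- At `(0, 0, 0, 0, m)` the vector `(1, 0, √m, 0, 0)` is an eigenvector for `√m`. -/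
theorem mbJacobian_mulVec_eq_sqrt_smul {m : ℝ} (hm : 0 ≤ m) :
    mbJacobian ![0, 0, 0, 0, m] *ᵥ ![1, 0, √m, 0, 0] = √m • ![1, 0, √m, 0, 0] := by
  ext i
  fin_cases i <;> simp [mbJacobian, Matrix.mulVec, dotProduct, Fin.sum_univ_succ, hm]

theorem e2_unstable_matignon (m : ℝ) (hm : 0 < m) :
    (mbJacobian ![0, 0, 0, 0, m]).charpoly.IsRoot (Real.sqrt m) ∧
    0 < Real.sqrt m ∧
    ∀ α : ℝ, 0 < α → α ≤ 1 →
      ∃ lam : ℂ, lam ≠ 0 ∧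
        ((mbJacobian ![0, 0, 0, 0, m]).charpoly.map (algebraMap ℝ ℂ)).IsRoot lam ∧
        |lam.arg| < α * Real.pi / 2 := by
  have hpos : 0 < √m := Real.sqrt_pos.mpr hm
  have hroot : (mbJacobian ![0, 0, 0, 0, m]).charpoly.IsRoot √m :=
    isRoot_charpoly_of_mulVec_eq_smul (fun h => one_ne_zero (congrFun h 0))
      (mbJacobian_mulVec_eq_sqrt_smul hm.le)
  refine ⟨hroot, hpos, fun α hα _ => ⟨(√m : ℝ), Complex.ofReal_ne_zero.mpr hpos.ne', ?_, ?_⟩⟩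
  · exact hroot.map (f := algebraMap ℝ ℂ)
  · rw [Complex.arg_ofReal_of_nonneg hpos.le, abs_zero]
    positivity
end

section
/- For all m, k₁, …, k₅ ∈ ℝ, the characteristic polynomial of the controlled Jacobian J(e₂^m, k) at the equilibrium e₂^m = (0, 0, 0, 0, m) factors as (X + k₅) · (X² + (k₁ + k₃)X + (k₁k₃ − m)) · (X² + (k₂ + k₄)X + (k₂k₄ − m)). -/
open Polynomial Matrix

theorem charpoly_ctrl_e2 (m k₁ k₂ k₃ k₄ k₅ : ℝ) :
    (mbJacobianCtrl ![0, 0, 0, 0, m] ![k₁, k₂, k₃, k₄, k₅]).charpoly =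
      (X + C k₅) * (X ^ 2 + C (k₁ + k₃) * X + C (k₁ * k₃ - m)) *
        (X ^ 2 + C (k₂ + k₄) * X + C (k₂ * k₄ - m)) := by
  simp [charpoly, charmatrix, mbJacobianCtrl, mbJacobian, det_succ_row_zero, Fin.sum_univ_succ,
    Fin.succAbove, diagonal_apply]
  ring
end

section
/- Let k₁, …, k₅ > 0, suppose |k₁ − k₃| = |k₂ − k₄| and m = −(k₁ − k₃)²/4 ≠ 0. Then every eigenvalue of the controlled Jacobian J(e₂^m, k), where e₂^m = (0, 0, 0, 0, m), is a negative real number; consequently every eigenvalue λ satisfies |Arg λ| = π > απ/2 for every α ∈ (0, 1]. -/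
open Polynomial Matrix

/-- At the equilibrium `(0, 0, 0, 0, m)` the controlled characteristic polynomial splits into a
linear factor and two quadratic ones. -/
theorem charpoly_mbJacobianCtrl_e2 (m k₁ k₂ k₃ k₄ k₅ : ℝ) :
    (mbJacobianCtrl ![0, 0, 0, 0, m] ![k₁, k₂, k₃, k₄, k₅]).charpoly =
      (X + C k₅) * ((X + C k₁) * (X + C k₃) - C m) * ((X + C k₂) * (X + C k₄) - C m) := by
  have hmat : (mbJacobianCtrl ![0, 0, 0, 0, m] ![k₁, k₂, k₃, k₄, k₅]).charmatrix =
      !![X + C k₁, 0, -1, 0, 0;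
         0, X + C k₂, 0, -1, 0;
         -C m, 0, X + C k₃, 0, 0;
         0, -C m, 0, X + C k₄, 0;
         0, 0, 0, 0, X + C k₅] := by
    ext1 i j
    fin_cases i <;> fin_cases j <;> simp [mbJacobianCtrl, mbJacobian]
  rw [Matrix.charpoly, hmat]
  simp [Matrix.det_succ_row_zero, Fin.sum_univ_succ, Fin.succAbove]
  ring

/-- A root of `(X + a) (X + b) + (a - b)² / 4` is the double root `-(a + b) / 2`. -/
theorem eq_neg_half_add_of_mul_sub_eq_zero {a b m : ℝ} (hm : m = -(a - b) ^ 2 / 4) {z : ℂ}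
    (hz : (z + a) * (z + b) - m = 0) : z = ((-(a + b) / 2 : ℝ) : ℂ) := by
  have hsq : (z + (a + b) / 2) ^ 2 = 0 := by
    rw [← hz, hm]
    push_cast
    ring
  push_cast
  linear_combination pow_eq_zero_iff two_ne_zero |>.mp hsq

theorem ctrl_e2_stable_case1 (m k₁ k₂ k₃ k₄ k₅ : ℝ)
    (h₁ : 0 < k₁) (h₂ : 0 < k₂) (h₃ : 0 < k₃) (h₄ : 0 < k₄) (h₅ : 0 < k₅)
    (habs : |k₁ - k₃| = |k₂ - k₄|)
    (hm : m = -(k₁ - k₃) ^ 2 / 4) (hm0 : m ≠ 0) :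
    ∀ lam : ℂ,
      ((mbJacobianCtrl ![0, 0, 0, 0, m] ![k₁, k₂, k₃, k₄, k₅]).charpoly.map
        (algebraMap ℝ ℂ)).IsRoot lam →
      (∃ r : ℝ, r < 0 ∧ lam = (r : ℂ)) ∧ |lam.arg| = Real.pi ∧
        ∀ α : ℝ, 0 < α → α ≤ 1 → α * Real.pi / 2 < |lam.arg| := by
  intro lam hroot
  have hm' : m = -(k₂ - k₄) ^ 2 / 4 := by rw [hm, ← sq_abs (k₁ - k₃), habs, sq_abs]
  obtain ⟨r, hr, rfl⟩ : ∃ r : ℝ, r < 0 ∧ lam = (r : ℂ) := by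
    rw [charpoly_mbJacobianCtrl_e2] at hroot
    simp only [IsRoot.def, Polynomial.map_mul, Polynomial.map_sub, Polynomial.map_add, map_X,
      map_C, eval_mul, eval_sub, eval_add, eval_X, eval_C, Complex.coe_algebraMap,
      mul_eq_zero (a := _ * (_ - _)), mul_eq_zero (b := _ - _)] at hroot
    rcases hroot with (h | h) | h
    · exact ⟨-k₅, by linarith, by push_cast; linear_combination h⟩
    · exact ⟨_, by linarith, eq_neg_half_add_of_mul_sub_eq_zero hm h⟩
    · exact ⟨_, by linarith, eq_neg_half_add_of_mul_sub_eq_zero hm' h⟩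
  have harg : |(r : ℂ).arg| = Real.pi := by
    rw [Complex.arg_ofReal_of_neg hr, abs_of_pos Real.pi_pos]
  refine ⟨⟨r, hr, rfl⟩, harg, fun α _ hα => ?_⟩
  rw [harg]
  nlinarith [Real.pi_pos]
end

section
/- Let k₁, …, k₅ > 0 and suppose max{−(k₁ − k₃)²/4, −(k₂ − k₄)²/4} < m < min{k₁k₃, k₂k₄}. Then every eigenvalue of the controlled Jacobian J(e₂^m, k), where e₂^m = (0, 0, 0, 0, m), is a negative real number; consequently every eigenvalue λ satisfies |Arg λ| > απ/2 for every α ∈ (0, 1]. -/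
open Polynomial Matrix

/-- A complex root of `(z + a) * (z + b) = m` is real and negative when `a, b > 0`, the discriminant
is positive and `m < a * b`. -/
theorem exists_neg_real_of_shifted_mul_eq {a b m : ℝ} (ha : 0 < a) (hb : 0 < b)
    (hlo : -(a - b) ^ 2 / 4 < m) (hhi : m < a * b) {z : ℂ} (hz : (z + a) * (z + b) - m = 0) :
    ∃ r : ℝ, r < 0 ∧ z = (r : ℂ) := by
  have hre := congrArg Complex.re hz
  have him := congrArg Complex.im hz
  simp at hre him
  have hy : z.im = 0 := by
    by_contra hy
    have hx : 2 * z.re + a + b = 0 :=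
      (mul_eq_zero.mp (by linear_combination him : z.im * (2 * z.re + a + b) = 0)).resolve_left hy
    have hx' : z.re = -(a + b) / 2 := by linarith
    rw [hx'] at hre
    nlinarith [sq_nonneg z.im]
  refine ⟨z.re, ?_, Complex.ext rfl (by simpa using hy)⟩
  rw [hy] at hre
  by_contra! h
  nlinarith [mul_nonneg h h, mul_nonneg h ha.le, mul_nonneg h hb.le]

theorem ctrl_e2_stable_case2 (m k₁ k₂ k₃ k₄ k₅ : ℝ)
    (h₁ : 0 < k₁) (h₂ : 0 < k₂) (h₃ : 0 < k₃) (h₄ : 0 < k₄) (h₅ : 0 < k₅)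
    (hlo : max (-(k₁ - k₃) ^ 2 / 4) (-(k₂ - k₄) ^ 2 / 4) < m)
    (hhi : m < min (k₁ * k₃) (k₂ * k₄)) :
    ∀ lam : ℂ,
      ((mbJacobianCtrl ![0, 0, 0, 0, m] ![k₁, k₂, k₃, k₄, k₅]).charpoly.map
        (algebraMap ℝ ℂ)).IsRoot lam →
      (∃ r : ℝ, r < 0 ∧ lam = (r : ℂ)) ∧
        ∀ α : ℝ, 0 < α → α ≤ 1 → α * Real.pi / 2 < |lam.arg| := by
  intro lam hroot
  obtain ⟨hlo₁, hlo₂⟩ := max_lt_iff.mp hlo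
  obtain ⟨hhi₁, hhi₂⟩ := lt_min_iff.mp hhi
  have hneg : ∃ r : ℝ, r < 0 ∧ lam = (r : ℂ) := by
    rw [charpoly_mbJacobianCtrl_e2] at hroot
    simp only [IsRoot.def, Polynomial.map_mul, Polynomial.map_sub, Polynomial.map_add, map_X, map_C,
      eval_mul, eval_sub, eval_add, eval_X, eval_C, Complex.coe_algebraMap, mul_eq_zero] at hroot
    rcases hroot with (h | h) | h
    · exact ⟨-k₅, neg_lt_zero.mpr h₅, by push_cast; linear_combination h⟩
    · exact exists_neg_real_of_shifted_mul_eq h₁ h₃ hlo₁ hhi₁ h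
    · exact exists_neg_real_of_shifted_mul_eq h₂ h₄ hlo₂ hhi₂ h
  refine ⟨hneg, fun α _ hα => ?_⟩
  obtain ⟨r, hr, rfl⟩ := hneg
  rw [Complex.arg_ofReal_of_neg hr, abs_of_pos Real.pi_pos]
  nlinarith [Real.pi_pos]
end

section
/- For all m, n, k₁, …, k₅ ∈ ℝ, the characteristic polynomial of the controlled Jacobian J(e₁^{mn}, k) at the equilibrium e₁^{mn} = (m, n, 0, 0, 0) factors as (X + k₁)(X + k₂) · P(X), where P(X) = X³ + a₁X² + a₂X + a₃ with a₁ = k₃ + k₄ + k₅, a₂ = k₃k₄ + k₃k₅ + k₄k₅ + m² + n², and a₃ = k₃k₄k₅ + k₃n² + k₄m². -/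
open Polynomial Matrix

theorem charpoly_ctrl_e1 (m n k₁ k₂ k₃ k₄ k₅ : ℝ) :
    (mbJacobianCtrl ![m, n, 0, 0, 0] ![k₁, k₂, k₃, k₄, k₅]).charpoly =
      (X + C k₁) * (X + C k₂) *
        (X ^ 3 + C (k₃ + k₄ + k₅) * X ^ 2 +
          C (k₃ * k₄ + k₃ * k₅ + k₄ * k₅ + m ^ 2 + n ^ 2) * X +
          C (k₃ * k₄ * k₅ + k₃ * n ^ 2 + k₄ * m ^ 2)) := by
  have h : (mbJacobianCtrl ![m, n, 0, 0, 0] ![k₁, k₂, k₃, k₄, k₅]).charmatrix =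
      !![X + C k₁, 0, -1, 0, 0;
         0, X + C k₂, 0, -1, 0;
         0, 0, X + C k₃, 0, -C m;
         0, 0, 0, X + C k₄, -C n;
         0, 0, C m, C n, X + C k₅] := by
    ext1 i j
    fin_cases i <;> fin_cases j <;>
      simp [mbJacobianCtrl, mbJacobian]
  rw [Matrix.charpoly, h]
  simp [det_succ_row_zero, Fin.sum_univ_succ, Fin.succAbove]
  ring
end

section
/- Let m, n ∈ ℝ and k₃, k₄, k₅ > 0, and set a₁ = k₃ + k₄ + k₅, a₂ = k₃k₄ + k₃k₅ + k₄k₅ + m² + n², a₃ = k₃k₄k₅ + k₃n² + k₄m². Then a₁ > 0, a₂ > 0, a₃ > 0 and a₁a₂ − a₃ > 0. -/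
theorem cubic_coeffs_pos (m n k₃ k₄ k₅ : ℝ) (h₃ : 0 < k₃) (h₄ : 0 < k₄) (h₅ : 0 < k₅) :
    0 < k₃ + k₄ + k₅ ∧
    0 < k₃ * k₄ + k₃ * k₅ + k₄ * k₅ + m ^ 2 + n ^ 2 ∧
    0 < k₃ * k₄ * k₅ + k₃ * n ^ 2 + k₄ * m ^ 2 ∧
    0 < (k₃ + k₄ + k₅) * (k₃ * k₄ + k₃ * k₅ + k₄ * k₅ + m ^ 2 + n ^ 2) -
          (k₃ * k₄ * k₅ + k₃ * n ^ 2 + k₄ * m ^ 2) := by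
  refine ⟨by positivity, by positivity, by positivity, ?_⟩
  have key : 0 < (k₃ + k₄) * (k₃ + k₅) * (k₄ + k₅) + (k₃ + k₅) * m ^ 2 + (k₄ + k₅) * n ^ 2 := by
    positivity
  linear_combination key
end

section
/- Let m, n ∈ ℝ and k₁, …, k₅ > 0, and suppose the discriminant D(P) of the cubic P is positive. Then every eigenvalue λ of the controlled Jacobian J(e₁^{mn}, k) at e₁^{mn} = (m, n, 0, 0, 0) has negative real part; consequently |Arg λ| > απ/2 for every α ∈ (0, 1). -/
open Polynomial Matrix

/-- Coefficient a₁ of the cubic factor. -/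
noncomputable def coeffA1 (k₃ k₄ k₅ : ℝ) : ℝ := k₃ + k₄ + k₅

/-- Coefficient a₂ of the cubic factor. -/
noncomputable def coeffA2 (m n k₃ k₄ k₅ : ℝ) : ℝ :=
  k₃ * k₄ + k₃ * k₅ + k₄ * k₅ + m ^ 2 + n ^ 2

/-- Coefficient a₃ of the cubic factor. -/
noncomputable def coeffA3 (m n k₃ k₄ k₅ : ℝ) : ℝ :=
  k₃ * k₄ * k₅ + k₃ * n ^ 2 + k₄ * m ^ 2

/-- The discriminant D(P) of the cubic P(X) = X³ + a₁X² + a₂X + a₃. -/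
noncomputable def discrP (m n k₃ k₄ k₅ : ℝ) : ℝ :=
  18 * coeffA1 k₃ k₄ k₅ * coeffA2 m n k₃ k₄ k₅ * coeffA3 m n k₃ k₄ k₅ +
    (coeffA1 k₃ k₄ k₅) ^ 2 * (coeffA2 m n k₃ k₄ k₅) ^ 2 -
    4 * coeffA3 m n k₃ k₄ k₅ * (coeffA1 k₃ k₄ k₅) ^ 3 -
    4 * (coeffA2 m n k₃ k₄ k₅) ^ 3 - 27 * (coeffA3 m n k₃ k₄ k₅) ^ 2

/-- A complex root of the characteristic polynomial of a real matrix has an eigenvector. -/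
theorem exists_eigenvector_of_isRoot_charpoly_map {ι : Type*} [Fintype ι] [DecidableEq ι]
    (A : Matrix ι ι ℝ) {lam : ℂ} (h : (A.charpoly.map (algebraMap ℝ ℂ)).IsRoot lam) :
    ∃ v : ι → ℂ, v ≠ 0 ∧ A.map (algebraMap ℝ ℂ) *ᵥ v = lam • v := by
  rw [← Matrix.charpoly_map, Polynomial.IsRoot.def, Matrix.eval_charpoly] at h
  obtain ⟨v, hv, hA⟩ := Matrix.exists_mulVec_eq_zero_iff.2 h
  refine ⟨v, hv, ?_⟩
  rw [Matrix.sub_mulVec, sub_eq_zero] at hA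
  rw [← hA]
  simp [Matrix.scalar_apply, ← Matrix.smul_one_eq_diagonal, Matrix.smul_mulVec]

/-- An eigenvalue of the dissipative real matrix `!![-a, 0, m; 0, -b, n; -m, -n, -c]`, where
`a, b, c > 0`, has negative real part. -/
theorem re_neg_of_dissipative {a b c m n : ℝ} (ha : 0 < a) (hb : 0 < b) (hc : 0 < c)
    {lam x y z : ℂ} (hx : -a * x + m * z = lam * x) (hy : -b * y + n * z = lam * y)
    (hz : -m * x - n * y - c * z = lam * z) (hne : ¬(x = 0 ∧ y = 0 ∧ z = 0)) :
    lam.re < 0 := by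
  have key : lam.re * (Complex.normSq x + Complex.normSq y + Complex.normSq z) =
      -(a * Complex.normSq x + b * Complex.normSq y + c * Complex.normSq z) := by
    have hx1 := congrArg Complex.re hx
    have hx2 := congrArg Complex.im hx
    have hy1 := congrArg Complex.re hy
    have hy2 := congrArg Complex.im hy
    have hz1 := congrArg Complex.re hz
    have hz2 := congrArg Complex.im hz
    simp at hx1 hx2 hy1 hy2 hz1 hz2
    simp only [Complex.normSq_apply]
    linear_combination -x.re * hx1 - x.im * hx2 - y.re * hy1 - y.im * hy2 - z.re * hz1
      - z.im * hz2
  have hxn := Complex.normSq_nonneg x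
  have hyn := Complex.normSq_nonneg y
  have hzn := Complex.normSq_nonneg z
  have hpos : 0 < a * Complex.normSq x + b * Complex.normSq y + c * Complex.normSq z := by
    by_cases hx0 : x = 0
    · by_cases hy0 : y = 0
      · have := Complex.normSq_pos.2 (fun hz0 => hne ⟨hx0, hy0, hz0⟩ : z ≠ 0)
        positivity
      · have := Complex.normSq_pos.2 hy0
        positivity
    · have := Complex.normSq_pos.2 hx0
      positivity
  by_contra! h
  have : 0 ≤ lam.re * (Complex.normSq x + Complex.normSq y + Complex.normSq z) := by positivity
  linarith

/-- For positive gains, every eigenvalue of the controlled Jacobian at `(m, n, 0, 0, 0)` has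
negative real part. -/
theorem ctrl_e1_re_neg {m n k₁ k₂ k₃ k₄ k₅ : ℝ}
    (h₁ : 0 < k₁) (h₂ : 0 < k₂) (h₃ : 0 < k₃) (h₄ : 0 < k₄) (h₅ : 0 < k₅) {lam : ℂ}
    (h : ((mbJacobianCtrl ![m, n, 0, 0, 0] ![k₁, k₂, k₃, k₄, k₅]).charpoly.map
      (algebraMap ℝ ℂ)).IsRoot lam) : lam.re < 0 := by
  obtain ⟨v, hv, hA⟩ := exists_eigenvector_of_isRoot_charpoly_map _ h
  have e0 := congrFun hA 0
  have e1 := congrFun hA 1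
  have e2 := congrFun hA 2
  have e3 := congrFun hA 3
  have e4 := congrFun hA 4
  simp [mbJacobianCtrl, mbJacobian, Matrix.mulVec, dotProduct, Fin.sum_univ_five,
    Matrix.diagonal_apply] at e0 e1 e2 e3 e4
  by_cases hw : v 2 = 0 ∧ v 3 = 0 ∧ v 4 = 0
  · obtain ⟨h2, h3, h4⟩ := hw
    have real_case : ∀ {k : ℝ} {x : ℂ}, 0 < k → x ≠ 0 → -(k * x) = lam * x → lam.re < 0 := by
      intro k x hk hx hkx
      have : lam = -(k : ℂ) := mul_right_cancel₀ hx (by rw [← hkx, neg_mul])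
      simp [this, hk]
    by_cases hv0 : v 0 = 0
    · refine real_case h₂ (x := v 1) (fun hv1 => hv ?_) (by simpa [h3] using e1)
      ext i
      fin_cases i <;> simp [*]
    · exact real_case h₁ hv0 (by simpa [h2] using e0)
  · exact re_neg_of_dissipative h₃ h₄ h₅ (m := m) (n := n) (x := v 2) (y := v 3) (z := v 4)
      (by linear_combination e2) (by linear_combination e3) (by linear_combination e4) hw

theorem ctrl_e1_stable_Dpos (m n k₁ k₂ k₃ k₄ k₅ : ℝ)
    (h₁ : 0 < k₁) (h₂ : 0 < k₂) (h₃ : 0 < k₃) (h₄ : 0 < k₄) (h₅ : 0 < k₅)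
    (hD : 0 < discrP m n k₃ k₄ k₅) :
    ∀ lam : ℂ,
      ((mbJacobianCtrl ![m, n, 0, 0, 0] ![k₁, k₂, k₃, k₄, k₅]).charpoly.map
        (algebraMap ℝ ℂ)).IsRoot lam →
      lam.re < 0 ∧ ∀ α : ℝ, 0 < α → α < 1 → α * Real.pi / 2 < |lam.arg| := by
  intro lam hlam
  have hre : lam.re < 0 := ctrl_e1_re_neg h₁ h₂ h₃ h₄ h₅ hlam
  refine ⟨hre, fun α _ hα1 => ?_⟩
  have harg : Real.pi / 2 < |lam.arg| := by
    by_contra! h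
    exact absurd (Complex.abs_arg_le_pi_div_two_iff.1 h) (not_le.2 hre)
  nlinarith [Real.pi_pos]
end

section
/- Let m, n ∈ ℝ and k₁, …, k₅ > 0, and suppose the discriminant D(P) of the cubic P is negative. Then every eigenvalue λ of the controlled Jacobian J(e₁^{mn}, k) at e₁^{mn} = (m, n, 0, 0, 0) satisfies |Arg λ| > απ/2 for every α ∈ (0, 2/3). -/
open Polynomial Matrix

/-- The characteristic polynomial of the controlled Jacobian at `(m, n, 0, 0, 0)` factors as two
linear factors times a cubic. -/
theorem charpoly_mbJacobianCtrl_e1 (m n k₁ k₂ k₃ k₄ k₅ : ℝ) :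
    (mbJacobianCtrl ![m, n, 0, 0, 0] ![k₁, k₂, k₃, k₄, k₅]).charpoly =
      (X + C k₁) * (X + C k₂) *
        ((X + C k₃) * (X + C k₄) * (X + C k₅) + C n ^ 2 * (X + C k₃) + C m ^ 2 * (X + C k₄)) := by
  simp [Matrix.charpoly, Matrix.charmatrix, mbJacobianCtrl, mbJacobian, Matrix.det_succ_row_zero,
    Fin.sum_univ_succ, Matrix.diagonal_apply, Fin.succAbove]
  ring

/-- Every root of `(z + a) (z + b) (z + c) + n² (z + a) + m² (z + b)` with `a, b, c > 0` lies in the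
open left half-plane. -/
theorem re_neg_of_cubic_eq_zero {m n a b c : ℝ} (ha : 0 < a) (hb : 0 < b) (hc : 0 < c) {z : ℂ}
    (hz : (z + a) * (z + b) * (z + c) + (n : ℂ) ^ 2 * (z + a) + (m : ℂ) ^ 2 * (z + b) = 0) :
    z.re < 0 := by
  by_contra! h
  have ha' : 0 < (z + a).re := by simp; linarith
  have hb' : 0 < (z + b).re := by simp; linarith
  have hza : z + a ≠ 0 := fun h0 => by simp [h0] at ha'
  have hzb : z + b ≠ 0 := fun h0 => by simp [h0] at hb'
  have key : (z + c) + ((n ^ 2 : ℝ) : ℂ) * (z + b)⁻¹ + ((m ^ 2 : ℝ) : ℂ) * (z + a)⁻¹ = 0 := by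
    push_cast
    field_simp
    linear_combination hz
  have hre := congrArg Complex.re key
  simp only [Complex.add_re, Complex.re_ofReal_mul, Complex.inv_re, Complex.zero_re,
    Complex.ofReal_re] at hre ha' hb'
  have hm : 0 ≤ m ^ 2 * ((z.re + a) / Complex.normSq (z + a)) :=
    mul_nonneg (sq_nonneg m) (div_nonneg ha'.le (Complex.normSq_nonneg _))
  have hn : 0 ≤ n ^ 2 * ((z.re + b) / Complex.normSq (z + b)) :=
    mul_nonneg (sq_nonneg n) (div_nonneg hb'.le (Complex.normSq_nonneg _))
  linarith

theorem ctrl_e1_stable_Dneg (m n k₁ k₂ k₃ k₄ k₅ : ℝ)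
    (h₁ : 0 < k₁) (h₂ : 0 < k₂) (h₃ : 0 < k₃) (h₄ : 0 < k₄) (h₅ : 0 < k₅)
    (hD : discrP m n k₃ k₄ k₅ < 0) :
    ∀ lam : ℂ,
      ((mbJacobianCtrl ![m, n, 0, 0, 0] ![k₁, k₂, k₃, k₄, k₅]).charpoly.map
        (algebraMap ℝ ℂ)).IsRoot lam →
      ∀ α : ℝ, 0 < α → α < 2 / 3 → α * Real.pi / 2 < |lam.arg| := by
  intro lam hroot α _ hα
  have hre : lam.re < 0 := by
    rw [charpoly_mbJacobianCtrl_e1, IsRoot.def] at hroot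
    simp only [Polynomial.map_mul, Polynomial.map_add, Polynomial.map_pow, map_X, map_C, eval_mul,
      eval_add, eval_pow, eval_X, eval_C, Complex.coe_algebraMap, mul_eq_zero] at hroot
    rcases hroot with (h | h) | h
    · rw [eq_neg_of_add_eq_zero_left h]
      simpa using h₁
    · rw [eq_neg_of_add_eq_zero_left h]
      simpa using h₂
    · exact re_neg_of_cubic_eq_zero h₃ h₄ h₅ h
  have harg : Real.pi / 2 < |lam.arg| := by
    rw [← not_le, Complex.abs_arg_le_pi_div_two_iff]
    exact not_le.mpr hre
  nlinarith [Real.pi_pos]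
end

section
/- Let m, n ∈ ℝ with m² + n² ≠ 0, let k₁, k₂ > 0, k₃ = k₄ = b with b > 2√(m² + n²), and k₅ = 0. Then every eigenvalue λ of the controlled Jacobian J(e₁^{mn}, k) at e₁^{mn} = (m, n, 0, 0, 0) has negative real part; consequently |Arg λ| > απ/2 for every α ∈ (0, 1). -/
open Polynomial Matrix

theorem mbJacobianCtrl_charpoly (m n b k₁ k₂ : ℝ) :
    (mbJacobianCtrl ![m, n, 0, 0, 0] ![k₁, k₂, b, b, 0]).charpoly =
      (X + C k₁) * (X + C k₂) * (X + C b) * (X ^ 2 + C b * X + C (m ^ 2 + n ^ 2)) := by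
  have hM : (mbJacobianCtrl ![m, n, 0, 0, 0] ![k₁, k₂, b, b, 0]).charmatrix =
      !![X + C k₁, 0, -1, 0, 0;
         0, X + C k₂, 0, -1, 0;
         0, 0, X + C b, 0, -C m;
         0, 0, 0, X + C b, -C n;
         0, 0, C m, C n, X] := by
    ext i j : 2
    fin_cases i <;> fin_cases j <;>
      simp [mbJacobianCtrl, mbJacobian]
  rw [Matrix.charpoly, hM]
  simp [det_succ_row_zero, Fin.sum_univ_succ, Fin.succAbove]
  ring

/-- Roots of a monic real quadratic with positive coefficients lie in the open left half-plane. -/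
theorem re_neg_of_quadratic_eq_zero {b c : ℝ} (hb : 0 < b) (hc : 0 < c) {z : ℂ}
    (hz : z ^ 2 + b * z + c = 0) : z.re < 0 := by
  have hre := congrArg Complex.re hz
  have him := congrArg Complex.im hz
  simp [pow_two] at hre him
  have hprod : z.im * (2 * z.re + b) = 0 := by linarith
  rcases mul_eq_zero.mp hprod with h | h
  · rw [h] at hre
    by_contra! hx
    nlinarith [mul_nonneg hb.le hx, mul_nonneg hx hx]
  · linarith

theorem re_neg_of_add_eq_zero {k : ℝ} (hk : 0 < k) {z : ℂ} (hz : z + k = 0) : z.re < 0 := by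
  have hre := congrArg Complex.re hz
  simp at hre
  linarith

theorem ctrl_e1_stable_b_large (m n b k₁ k₂ : ℝ)
    (hmn : m ^ 2 + n ^ 2 ≠ 0) (h₁ : 0 < k₁) (h₂ : 0 < k₂)
    (hb : 2 * Real.sqrt (m ^ 2 + n ^ 2) < b) :
    ∀ lam : ℂ,
      ((mbJacobianCtrl ![m, n, 0, 0, 0] ![k₁, k₂, b, b, 0]).charpoly.map
        (algebraMap ℝ ℂ)).IsRoot lam →
      lam.re < 0 ∧ ∀ α : ℝ, 0 < α → α < 1 → α * Real.pi / 2 < |lam.arg| := by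
  have hc : 0 < m ^ 2 + n ^ 2 := lt_of_le_of_ne (by positivity) hmn.symm
  have hb₀ : 0 < b := lt_of_le_of_lt (by positivity) hb
  intro lam hroot
  have hre : lam.re < 0 := by
    rw [mbJacobianCtrl_charpoly, IsRoot.def, eval_map_algebraMap] at hroot
    simp only [map_mul, map_add, map_pow, aeval_X, aeval_C, Complex.coe_algebraMap,
      mul_eq_zero] at hroot
    rcases hroot with ((h | h) | h) | h
    · exact re_neg_of_add_eq_zero h₁ h
    · exact re_neg_of_add_eq_zero h₂ h
    · exact re_neg_of_add_eq_zero hb₀ h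
    · exact re_neg_of_quadratic_eq_zero hb₀ hc (by push_cast; exact h)
  refine ⟨hre, fun α _ hα => ?_⟩
  have harg : Real.pi / 2 < |lam.arg| := by
    rw [← not_le, Complex.abs_arg_le_pi_div_two_iff]
    exact not_le.mpr hre
  nlinarith [Real.pi_pos]
end
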